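/- If A ⊆ ℝ² is a bounded set with A - A ⊇ S¹, then the Assouad dimension of A is at least 2/3. -/

import Mathlib

open Metric Filter Set Real
open scoped Topology Pointwise ENNReal

/-- Minimal number of balls of radius `r` needed to cover `F` (`⊤` if no finite cover). -/
noncomputable def coverN {E : Type*} [PseudoMetricSpace E] (r : ℝ) (F : Set E) : ℕ∞ :=
  ⨅ (S : Finset E) (_ : F ⊆ ⋃ x ∈ S, Metric.ball x r), (S.card : ℕ∞)

/-- Lower box (Minkowski) dimension. -/
noncomputable def lowerBoxDim {E : Type*} [PseudoMetricSpace E] (F : Set E) : ℝ :=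
  Filter.liminf (fun r : ℝ => Real.log ((coverN r F).toNat) / Real.log (1 / r)) (𝓝[>] 0)

/-- Upper box (Minkowski) dimension. -/
noncomputable def upperBoxDim {E : Type*} [PseudoMetricSpace E] (F : Set E) : ℝ :=
  Filter.limsup (fun r : ℝ => Real.log ((coverN r F).toNat) / Real.log (1 / r)) (𝓝[>] 0)

/-- Assouad dimension. -/
noncomputable def assouadDim {E : Type*} [PseudoMetricSpace E] (F : Set E) : ℝ :=
  sInf {s : ℝ | 0 ≤ s ∧ ∃ C > 0, ∀ x ∈ F, ∀ R > 0, ∀ r, 0 < r → r < R →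
    (((coverN r (Metric.closedBall x R ∩ F)).toNat : ℝ)) ≤ C * (R / r) ^ s}

abbrev DipE := EuclideanSpace ℝ (Fin 2)

lemma dip_cover_finset (F : Set DipE) (x : DipE) (R r : ℝ) (hr : 0 < r) (hrR : r < R) :
    ∃ n : ℕ, coverN r (Metric.closedBall x R ∩ F) ≤ (n : ℕ∞) ∧ (n : ℝ) ≤ 121 * (R / r) ^ (2 : ℝ) := by
  classical
  set m : ℤ := ⌈2 * R / r⌉ + 1 with hm
  have h1 : 1 < R / r := by rw [lt_div_iff₀ hr]; linarith
  have hm0 : 0 ≤ m := by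
    have : 0 ≤ ⌈2 * R / r⌉ := Int.ceil_nonneg (by have := hr.trans hrR; positivity)
    omega
  have hmle : (m : ℝ) ≤ 2 * (R / r) + 2 := by
    have := Int.ceil_lt_add_one (2 * R / r)
    rw [hm]; push_cast
    rw [mul_div_assoc] at *
    linarith
  have hmge : 2 * (R / r) + 1 ≤ (m : ℝ) := by
    have := Int.le_ceil (2 * R / r)
    rw [hm]; push_cast
    rw [mul_div_assoc] at *
    linarith
  let g : ℤ × ℤ → DipE := fun p => !₂[x 0 + r / 2 * p.1, x 1 + r / 2 * p.2]
  let S : Finset DipE := (Finset.Icc (-m) m ×ˢ Finset.Icc (-m) m).image g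
  refine ⟨S.card, ?_, ?_⟩
  · refine iInf₂_le S ?_
    intro y hy
    have hyR : dist y x ≤ R := hy.1
    rw [EuclideanSpace.dist_eq, Fin.sum_univ_two] at hyR
    have hR : 0 ≤ R := (hr.trans hrR).le
    rw [Real.sqrt_le_left hR, Real.dist_eq, Real.dist_eq, sq_abs, sq_abs] at hyR
    have hb : ∀ z : ℝ, z ^ 2 ≤ R ^ 2 → round (z / (r / 2)) ∈ Finset.Icc (-m) m ∧
        |z - r / 2 * round (z / (r / 2))| ≤ r / 4 := by
      intro z hz
      have h2 := abs_sub_round (z / (r / 2))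
      have hz' := abs_le_of_sq_le_sq' hz hR
      have h3 : |z / (r / 2)| ≤ 2 * (R / r) := by
        rw [abs_div, abs_of_pos (show 0 < r / 2 by positivity), div_le_iff₀ (by positivity)]
        have : 2 * (R / r) * (r / 2) = R := by field_simp
        rw [this]; exact abs_le.2 hz'
      rw [abs_le] at h2 h3
      refine ⟨?_, ?_⟩
      · rw [Finset.mem_Icc]
        constructor
        · have : (-m : ℝ) ≤ round (z / (r / 2)) := by linarith
          exact_mod_cast this
        · have : (round (z / (r / 2)) : ℝ) ≤ m := by linarith
          exact_mod_cast this
      · have h4 : z - r / 2 * round (z / (r / 2)) = r / 2 * (z / (r / 2) - round (z / (r / 2))) := by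
          field_simp
        rw [h4, abs_mul, abs_of_pos (show 0 < r / 2 by positivity)]
        have : |z / (r / 2) - round (z / (r / 2))| ≤ 1 / 2 := abs_le.2 h2
        nlinarith
    obtain ⟨a1, a2⟩ := hb (y 0 - x 0) (by nlinarith [sq_nonneg (y 1 - x 1)])
    obtain ⟨b1, b2⟩ := hb (y 1 - x 1) (by nlinarith [sq_nonneg (y 0 - x 0)])
    simp only [Set.mem_iUnion]
    refine ⟨g (round ((y 0 - x 0) / (r / 2)), round ((y 1 - x 1) / (r / 2))), ?_, ?_⟩
    · exact Finset.mem_image_of_mem _ (Finset.mem_product.2 ⟨a1, b1⟩)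
    · rw [Metric.mem_ball, EuclideanSpace.dist_eq, Fin.sum_univ_two, Real.sqrt_lt' hr,
        Real.dist_eq, Real.dist_eq, sq_abs, sq_abs]
      simp only [g]
      simp
      have a3 := sq_le_sq' (abs_le.1 a2).1 (abs_le.1 a2).2
      have b3 := sq_le_sq' (abs_le.1 b2).1 (abs_le.1 b2).2
      nlinarith
  · have h2 : S.card ≤ (2 * m + 1).toNat * (2 * m + 1).toNat := by
      refine Finset.card_image_le.trans ?_
      rw [Finset.card_product, Int.card_Icc]
      have : m + 1 - -m = 2 * m + 1 := by ring
      rw [this]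
    have h3 : (((2 * m + 1).toNat : ℕ) : ℝ) = 2 * m + 1 := by
      have : (((2 * m + 1).toNat : ℕ) : ℤ) = 2 * m + 1 := Int.toNat_of_nonneg (by omega)
      exact_mod_cast this
    have h4 : (S.card : ℝ) ≤ (2 * m + 1) * (2 * m + 1) := by
      rw [← h3]; exact_mod_cast h2
    refine h4.trans ?_
    rw [Real.rpow_two]
    have : (2 * (m : ℝ) + 1) ≤ 11 * (R / r) := by linarith
    have h0 : (0 : ℝ) ≤ m := by exact_mod_cast hm0
    nlinarith

lemma dip_nonempty (F : Set DipE) : {s : ℝ | 0 ≤ s ∧ ∃ C > 0, ∀ x ∈ F, ∀ R > 0, ∀ r, 0 < r → r < R →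
    (((coverN r (Metric.closedBall x R ∩ F)).toNat : ℝ)) ≤ C * (R / r) ^ s}.Nonempty := by
  refine ⟨2, by norm_num, 121, by norm_num, ?_⟩
  intro x _ R _ r hr hrR
  obtain ⟨n, h1, h2⟩ := dip_cover_finset F x R r hr hrR
  refine le_trans ?_ h2
  exact_mod_cast ENat.toNat_le_of_le_natCast h1

/-- separated finite subsets are controlled -/
lemma dip_sep (A : Set DipE) (s C : ℝ)
    (hC : ∀ x ∈ A, ∀ R > 0, ∀ r, 0 < r → r < R →
      (((coverN r (Metric.closedBall x R ∩ A)).toNat : ℝ)) ≤ C * (R / r) ^ s)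
    (T : Finset DipE) (d R : ℝ) (hd : 0 < d) (hR : d ≤ R) (x : DipE) (hx : x ∈ A)
    (hTA : ∀ y ∈ T, y ∈ A) (hTR : ∀ y ∈ T, dist y x ≤ R)
    (hsep : ∀ y ∈ T, ∀ z ∈ T, dist y z < d → y = z) :
    (T.card : ℝ) ≤ C * (2 * (R / d)) ^ s := by
  classical
  have h1 := hC x hx R (by linarith) (d / 2) (by linarith) (by linarith)
  have h2 : R / (d / 2) = 2 * (R / d) := by field_simp
  rw [h2] at h1
  refine le_trans ?_ h1
  obtain ⟨n, hn, -⟩ := dip_cover_finset A x R (d / 2) (by linarith) (by linarith)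
  have hne : coverN (d / 2) (Metric.closedBall x R ∩ A) ≠ ⊤ := ne_top_of_le_ne_top (ENat.natCast_ne_top n) hn
  have h3 : (T.card : ℕ∞) ≤ coverN (d / 2) (Metric.closedBall x R ∩ A) := by
    refine le_iInf₂ ?_
    intro S hS
    have : ∀ y : DipE, ∃ z, y ∈ T → z ∈ S ∧ dist y z < d / 2 := by
      intro y
      by_cases hy : y ∈ T
      · have := hS ⟨hTR y hy, hTA y hy⟩
        simp only [Set.mem_iUnion, Metric.mem_ball] at this
        obtain ⟨z, hz, hz'⟩ := this
        exact ⟨z, fun _ => ⟨hz, hz'⟩⟩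
      · exact ⟨y, fun h => absurd h hy⟩
    choose f hf using this
    have : T.card ≤ S.card := by
      refine Finset.card_le_card_of_injOn f (fun y hy => (hf y hy).1) ?_
      intro y hy z hz hyz
      refine hsep y hy z hz ?_
      have h5 := (hf y hy).2
      have h6 := (hf z hz).2
      rw [← hyz] at h6
      have := dist_triangle_right y z (f y)
      linarith
    exact_mod_cast this
  have h4 := ENat.toNat_le_toNat h3 hne
  rw [ENat.toNat_natCast] at h4
  exact_mod_cast h4

/-- maximal separated subset -/
lemma dip_maxsep (T : Finset DipE) (d : ℝ) (hd : 0 < d) : ∃ P : Finset DipE, P ⊆ T ∧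
    (∀ y ∈ P, ∀ z ∈ P, dist y z < d → y = z) ∧ ∀ y ∈ T, ∃ z ∈ P, dist y z < d := by
  classical
  let Q := T.powerset.filter (fun P => ∀ y ∈ P, ∀ z ∈ P, dist y z < d → y = z)
  have hQ : Q.Nonempty := ⟨∅, by simp [Q]⟩
  obtain ⟨P, hP, hmax⟩ := Finset.exists_max_image Q Finset.card hQ
  simp only [Q, Finset.mem_filter, Finset.mem_powerset] at hP hmax
  refine ⟨P, hP.1, hP.2, ?_⟩
  intro y hy
  by_contra! hcon
  have hyP : y ∉ P := fun h => by have := hcon y h; rw [dist_self] at this; linarith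
  have := hmax (insert y P) ⟨Finset.insert_subset hy hP.1, by
    intro u hu v hv huv
    rw [Finset.mem_insert] at hu hv
    rcases hu with rfl | hu <;> rcases hv with rfl | hv
    · rfl
    · exact absurd huv (not_lt.2 (hcon v hv))
    · rw [dist_comm] at huv; exact absurd huv (not_lt.2 (hcon u hu))
    · exact hP.2 u hu v hv huv⟩
  rw [Finset.card_insert_of_notMem hyP] at this
  omega

noncomputable def dipe (t : ℝ) : DipE := !₂[Real.cos t, Real.sin t]

lemma dipe_dist (a b : ℝ) : dist (dipe a) (dipe b) = 2 * |Real.sin ((a - b) / 2)| := by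
  rw [EuclideanSpace.dist_eq, Fin.sum_univ_two, Real.dist_eq, Real.dist_eq, sq_abs, sq_abs]
  simp only [dipe]
  have : (2 * |Real.sin ((a - b) / 2)|) = Real.sqrt ((2 * Real.sin ((a - b) / 2)) ^ 2) := by
    rw [Real.sqrt_sq_eq_abs, abs_mul]; norm_num
  rw [this]
  congr 1
  have h1 : Real.cos (a - b) = 1 - 2 * Real.sin ((a - b) / 2) ^ 2 := by
    have h := Real.cos_two_mul ((a - b) / 2)
    have h' := Real.sin_sq_add_cos_sq ((a - b) / 2)
    rw [show 2 * ((a - b) / 2) = a - b by ring] at h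
    linarith
  rw [Real.cos_sub] at h1
  have := Real.sin_sq_add_cos_sq a
  have := Real.sin_sq_add_cos_sq b
  simp
  nlinarith

lemma dipe_le (a b : ℝ) : dist (dipe a) (dipe b) ≤ |a - b| := by
  rw [dipe_dist]
  have := Real.abs_sin_le_abs (x := (a - b) / 2)
  rw [abs_div, abs_two] at this
  linarith

lemma dip_sin_ge (x : ℝ) (hx : |x| ≤ 1) : |x| / 2 ≤ |Real.sin x| := by
  have h := Real.mul_abs_le_abs_sin (x := x) (by have := Real.pi_gt_three; linarith)
  have : 1 / 2 ≤ 2 / Real.pi := by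
    rw [div_le_div_iff₀ (by norm_num) Real.pi_pos]; linarith [Real.pi_le_four]
  nlinarith [abs_nonneg x]

lemma dipe_ge (a b : ℝ) (h : |a - b| ≤ 1) : |a - b| / 2 ≤ dist (dipe a) (dipe b) := by
  rw [dipe_dist]
  have h1 : |(a - b) / 2| = |a - b| / 2 := by rw [abs_div, abs_two]
  have := dip_sin_ge ((a - b) / 2) (by rw [h1]; linarith [abs_nonneg (a - b)])
  linarith

set_option maxHeartbeats 1000000 in
lemma dip_geom (a b a' b' d t : ℝ) (hb : 0 ≤ b) (hba : b ≤ a) (ha : a ≤ 1) (hb' : 0 ≤ b') (hba' : b' ≤ a')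
    (ha' : a' ≤ 1) (ht : 0 < t) (htl : t ≤ a' - b')
    (hd : ‖(dipe a - dipe b) - (dipe a' - dipe b')‖ ≤ 8 * d) :
    |a - a'| ≤ 42 * d / t := by
  have hd0 : 0 ≤ d := by have := norm_nonneg ((dipe a - dipe b) - (dipe a' - dipe b')); linarith
  have ht1 : t ≤ 1 := by linarith
  -- angular part
  set p := (a + b) / 2 with hp
  set p' := (a' + b') / 2 with hp'
  set q := (a - b) / 2 with hq
  set q' := (a' - b') / 2 with hq'
  have ea : a = p + q := by rw [hp, hq]; ring
  have eb : b = p - q := by rw [hp, hq]; ring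
  have ea' : a' = p' + q' := by rw [hp', hq']; ring
  have eb' : b' = p' - q' := by rw [hp', hq']; ring
  have hn := hd
  rw [EuclideanSpace.norm_eq, Fin.sum_univ_two, Real.sqrt_le_left (by linarith), Real.norm_eq_abs,
    Real.norm_eq_abs, sq_abs, sq_abs] at hn
  simp only [dipe, PiLp.sub_apply] at hn
  simp at hn
  set X := cos a - cos b - (cos a' - cos b') with hX
  set Y := sin a - sin b - (sin a' - sin b') with hY
  have key1 : X * cos p + Y * sin p = 2 * (sin q' * sin (p' - p)) := by
    have hid : ∀ p q p' q' : ℝ, (cos (p + q) - cos (p - q) - (cos (p' + q') - cos (p' - q'))) * cos p +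
        (sin (p + q) - sin (p - q) - (sin (p' + q') - sin (p' - q'))) * sin p =
        2 * (sin q' * sin (p' - p)) := by
      intro p q p' q'
      rw [Real.cos_add, Real.cos_sub, Real.cos_add, Real.cos_sub, Real.sin_add, Real.sin_sub, Real.sin_add,
        Real.sin_sub, Real.sin_sub]
      ring
    have := hid p q p' q'
    rwa [← ea, ← eb, ← ea', ← eb'] at this
  have key2 : (X * cos p + Y * sin p) ^ 2 ≤ (8 * d) ^ 2 := by
    have h1 := Real.sin_sq_add_cos_sq p
    have : (X * cos p + Y * sin p) ^ 2 + (X * sin p - Y * cos p) ^ 2 = X ^ 2 + Y ^ 2 := by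
      linear_combination (X ^ 2 + Y ^ 2) * h1
    nlinarith [sq_nonneg (X * sin p - Y * cos p)]
  have key3 : 2 * (|sin q'| * |sin (p' - p)|) ≤ 8 * d := by
    have := abs_le_of_sq_le_sq key2 (by linarith)
    rw [key1] at this
    simpa [abs_mul] using this
  have s1 := dip_sin_ge q' (by rw [abs_le]; constructor <;> linarith)
  have s2 := dip_sin_ge (p' - p) (by rw [abs_le]; constructor <;> linarith)
  rw [abs_of_nonneg (show 0 ≤ q' by linarith)] at s1
  have hpp : |p' - p| * t ≤ 32 * d := by
    have : t / 4 * (|p' - p| / 2) ≤ |sin q'| * |sin (p' - p)| := by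
      apply mul_le_mul (by linarith) s2 (by positivity) (by positivity)
    linarith
  -- radial part
  have r1 : |dist (dipe a) (dipe b) - dist (dipe a') (dipe b')| ≤ 8 * d := by
    rw [dist_eq_norm, dist_eq_norm]
    exact (abs_norm_sub_norm_le _ _).trans hd
  rw [dipe_dist, dipe_dist, ← hq, ← hq', abs_of_nonneg (Real.sin_nonneg_of_nonneg_of_le_pi (by linarith)
    (by linarith [Real.pi_gt_three])), abs_of_nonneg (Real.sin_nonneg_of_nonneg_of_le_pi (x := q') (by linarith)
    (by linarith [Real.pi_gt_three]))] at r1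
  have r2 : 2 * sin q - 2 * sin q' = 4 * (sin ((q - q') / 2) * cos ((q + q') / 2)) := by
    rw [← mul_sub, Real.sin_sub_sin]; ring
  rw [r2, abs_mul, abs_mul] at r1
  have r3 : 7 / 8 ≤ |cos ((q + q') / 2)| := by
    have := Real.one_sub_sq_div_two_le_cos (x := (q + q') / 2)
    refine le_trans ?_ (le_abs_self _)
    have h5 : (q + q') / 2 ≤ 1 / 2 := by linarith
    have h6 : 0 ≤ (q + q') / 2 := by linarith
    have h7 : ((q + q') / 2) ^ 2 ≤ (1 / 2) ^ 2 := pow_le_pow_left₀ h6 h5 2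
    linarith
  have s3 := dip_sin_ge ((q - q') / 2) (by rw [abs_le]; constructor <;> linarith)
  rw [abs_div, abs_two] at s3
  have hqq : |q - q'| ≤ 10 * d := by
    have : |q - q'| / 2 / 2 * (7 / 8) ≤ |sin ((q - q') / 2)| * |cos ((q + q') / 2)| := by
      apply mul_le_mul s3 r3 (by positivity) (by positivity)
    rw [abs_of_pos (show (0:ℝ) < 4 by norm_num)] at r1
    linarith
  rw [le_div_iff₀ ht]
  have : |a - a'| ≤ |p' - p| + |q - q'| := by
    rw [ea, ea', abs_sub_comm p' p]
    refine le_trans (le_of_eq ?_) (abs_add_le _ _)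
    congr 1; ring
  have h7 : |a - a'| * t ≤ (|p' - p| + |q - q'|) * t := mul_le_mul_of_nonneg_right this ht.le
  have h8 : |q - q'| * t ≤ |q - q'| * 1 := mul_le_mul_of_nonneg_left ht1 (abs_nonneg _)
  linarith

lemma dip_card_fib {α β : Type*} [DecidableEq β] (S : Finset α) (f : α → β) (N M : ℝ) (hN : 0 ≤ N)
    (h : ∀ x ∈ S, ((S.filter (fun y => f y = f x)).card : ℝ) ≤ N) (hM : ((S.image f).card : ℝ) ≤ M) :
    (S.card : ℝ) ≤ M * N := by
  classical
  have h1 : (S.card : ℝ) ≤ (S.image f).card * N := by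
    rw [Finset.card_eq_sum_card_image f S]
    push_cast
    rw [← nsmul_eq_mul]
    refine Finset.sum_le_card_nsmul _ _ _ ?_
    intro y hy
    obtain ⟨x, hx, rfl⟩ := Finset.mem_image.1 hy
    exact h x hx
  exact h1.trans (mul_le_mul_of_nonneg_right hM hN)

lemma dip_near {x y z : DipE} {d : ℝ} (h1 : dist x z < d) (h2 : dist y z < d) : dist x y ≤ 2 * d := by
  have := dist_triangle_right x y z
  linarith

lemma dip_index (J k l : ℕ) (hk : k < 2 ^ J) (hl : l < 2 ^ J)
    (h : dist (dipe (k * ((2 : ℝ) ^ J)⁻¹)) (dipe (l * ((2 : ℝ) ^ J)⁻¹)) ≤ 4 * ((2 : ℝ) ^ J)⁻¹) :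
    k ∈ Finset.Icc (l - 8) (l + 8) := by
  have hpos : (0 : ℝ) < 2 ^ J := by positivity
  have e : (k * ((2 : ℝ) ^ J)⁻¹) - (l * ((2 : ℝ) ^ J)⁻¹) = ((k : ℝ) - l) * ((2 : ℝ) ^ J)⁻¹ := by ring
  have hk' : (k : ℝ) < 2 ^ J := by exact_mod_cast hk
  have hl' : (l : ℝ) < 2 ^ J := by exact_mod_cast hl
  have hk0 : (0 : ℝ) ≤ k := by positivity
  have hl0 : (0 : ℝ) ≤ l := by positivity
  have e2 : |(k * ((2 : ℝ) ^ J)⁻¹) - (l * ((2 : ℝ) ^ J)⁻¹)| = |(k : ℝ) - l| * ((2 : ℝ) ^ J)⁻¹ := by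
    rw [e, abs_mul, abs_of_pos (inv_pos.2 hpos)]
  have h1 := dipe_ge (k * ((2 : ℝ) ^ J)⁻¹) (l * ((2 : ℝ) ^ J)⁻¹) (by
    rw [e2, ← div_eq_mul_inv, div_le_one hpos, abs_le]
    constructor <;> linarith)
  rw [e2] at h1
  have h2 : |(k : ℝ) - l| * ((2 : ℝ) ^ J)⁻¹ ≤ 8 * ((2 : ℝ) ^ J)⁻¹ := by linarith
  have h3 := le_of_mul_le_mul_right h2 (inv_pos.2 hpos)
  rw [abs_le] at h3
  rw [Finset.mem_Icc]
  have a1 : (k : ℝ) ≤ l + 8 := by linarith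
  have a2 : (l : ℝ) ≤ k + 8 := by linarith
  have a1' : k ≤ l + 8 := by exact_mod_cast a1
  have a2' : l ≤ k + 8 := by exact_mod_cast a2
  omega

lemma dip_scale (A : Set DipE) (s C : ℝ) (hs : 0 ≤ s) (hC0 : 0 < C)
    (hC : ∀ x ∈ A, ∀ R > 0, ∀ r, 0 < r → r < R →
      (((coverN r (Metric.closedBall x R ∩ A)).toNat : ℝ)) ≤ C * (R / r) ^ s)
    (J j : ℕ) (d : ℝ) (hd : d = ((2 : ℝ) ^ J)⁻¹) (a b p q : ℕ → DipE)
    (hab : ∀ k < 2 ^ J, a k - b k = dipe (k * d))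
    (P : Finset DipE) (hPA : ∀ y ∈ P, y ∈ A) (hsep : ∀ y ∈ P, ∀ z ∈ P, dist y z < d → y = z)
    (hpP : ∀ k < 2 ^ J, p k ∈ P) (hqP : ∀ k < 2 ^ J, q k ∈ P)
    (hap : ∀ k < 2 ^ J, dist (a k) (q k) < d) (hbp : ∀ k < 2 ^ J, dist (b k) (p k) < d)
    (S : Finset (ℕ × ℕ)) (hS : ∀ x ∈ S, x.1 < 2 ^ J ∧ x.2 < 2 ^ J ∧ x.2 ≤ x.1 ∧ p x.1 = p x.2 ∧
      Nat.log 2 (x.1 - x.2) = j) :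
    (S.card : ℝ) ≤ P.card * ((C * (12 * 2 ^ j) ^ s) * ((C * (92 * (2 ^ J / 2 ^ j)) ^ s) * 289)) := by
  classical
  have hJ : (0 : ℝ) < 2 ^ J := by positivity
  have hj : (0 : ℝ) < 2 ^ j := by positivity
  have hd0 : 0 < d := by rw [hd]; positivity
  have hj1 : (1 : ℝ) ≤ 2 ^ j := one_le_pow₀ (by norm_num)
  have hdj : ∀ x ∈ S, d ≤ 1 / 2 ^ j := by
    intro x hx
    obtain ⟨h1, h2, h3, h4, h5⟩ := hS x hx
    rw [hd, ← one_div]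
    apply one_div_le_one_div_of_le hj
    apply pow_le_pow_right₀ (by norm_num)
    rw [← h5]
    have : Nat.log 2 (x.1 - x.2) ≤ Nat.log 2 (2 ^ J) := Nat.log_mono_right (by omega)
    rwa [Nat.log_pow (by norm_num)] at this
  have hth : ∀ k : ℕ, k < 2 ^ J → (0 : ℝ) ≤ k * d ∧ k * d ≤ 1 := by
    intro k hk
    refine ⟨by positivity, ?_⟩
    rw [hd, ← div_eq_mul_inv, div_le_one hJ]
    exact_mod_cast hk.le
  -- difference of unit vectors
  have hdiff : ∀ k : ℕ, k < 2 ^ J → ∀ l : ℕ, l < 2 ^ J → dist (dipe (k * d)) (dipe (l * d)) ≤ dist (a k) (a l) + dist (b k) (b l) := by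
    intro k hk l hl
    rw [← hab k hk, ← hab l hl]
    exact dist_sub_sub_le _ _ _ _
  have hq2 : ∀ k < 2 ^ J, ∀ l < 2 ^ J, q k = q l → dist (a k) (a l) ≤ 2 * d := by
    intro k hk l hl h
    have h1 := hap k hk
    rw [h] at h1
    exact dip_near h1 (hap l hl)
  have hp2 : ∀ k < 2 ^ J, ∀ l < 2 ^ J, p k = p l → dist (b k) (b l) ≤ 2 * d := by
    intro k hk l hl h
    have h1 := hbp k hk
    rw [h] at h1
    exact dip_near h1 (hbp l hl)
  refine dip_card_fib S (fun x => q x.1) _ _ (by positivity) ?_ ?_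
  swap
  · have : S.image (fun x => q x.1) ⊆ P := by
      intro y hy
      obtain ⟨x, hx, rfl⟩ := Finset.mem_image.1 hy
      exact hqP _ (hS x hx).1
    exact_mod_cast Finset.card_le_card this
  rintro ⟨k0, l0⟩ h0
  refine dip_card_fib _ (fun x => q x.2) _ _ (by positivity) ?_ ?_
  swap
  · have h00 := hS _ h0
    have := dip_sep A s C hC ((S.filter (fun y => q y.1 = q k0)).image (fun x => q x.2)) d (6 * 2 ^ j * d)
      hd0 (by nlinarith) (q k0) (hPA _ (hqP _ h00.1)) ?_ ?_ ?_
    · have e : 2 * (6 * 2 ^ j * d / d) = 12 * 2 ^ j := by field_simp; norm_num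
      rwa [e] at this
    · intro y hy
      obtain ⟨x, hx, rfl⟩ := Finset.mem_image.1 hy
      rw [Finset.mem_filter] at hx
      exact hPA _ (hqP _ (hS x hx.1).2.1)
    · intro y hy
      obtain ⟨⟨k, l⟩, hx, rfl⟩ := Finset.mem_image.1 hy
      rw [Finset.mem_filter] at hx
      obtain ⟨h1, h2, h3, h4, h5⟩ := hS _ hx.1
      simp only at h1 h2 h3 h4 h5 hx ⊢
      rw [← hx.2]
      have hlog : k - l < 2 ^ (j + 1) := by
        rw [← h5]; exact Nat.lt_pow_succ_log_self (by norm_num) _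
      have hlog' : (k : ℝ) - l ≤ 2 * 2 ^ j := by
        have : ((k - l : ℕ) : ℝ) ≤ 2 ^ (j + 1) := by exact_mod_cast hlog.le
        rw [Nat.cast_sub h3, pow_succ] at this
        linarith
      have c1 := dipe_le (k * d) (l * d)
      have c2 : |(k : ℝ) * d - l * d| ≤ 2 * 2 ^ j * d := by
        rw [← sub_mul, abs_mul, abs_of_pos hd0, abs_of_nonneg (by
          have : (l : ℝ) ≤ k := by exact_mod_cast h3
          linarith)]
        exact mul_le_mul_of_nonneg_right hlog' hd0.le
      have c3 : dist (a l) (a k) ≤ dist (dipe (k * d)) (dipe (l * d)) + dist (b k) (b l) := by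
        rw [← hab k h1, ← hab l h2, dist_comm (a l), dist_eq_norm, dist_eq_norm, dist_eq_norm]
        refine le_trans (le_of_eq ?_) (norm_add_le _ _)
        congr 1; abel
      have c4 := hp2 k h1 l h2 h4
      have c5 := hap k h1
      have c6 := hap l h2
      have c7 := dist_triangle4 (q l) (a l) (a k) (q k)
      rw [dist_comm (q l) (a l)] at c7
      nlinarith
    · intro y hy z hz
      obtain ⟨x, hx, rfl⟩ := Finset.mem_image.1 hy
      obtain ⟨x', hx', rfl⟩ := Finset.mem_image.1 hz
      rw [Finset.mem_filter] at hx hx'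
      exact hsep _ (hqP _ (hS x hx.1).2.1) _ (hqP _ (hS x' hx'.1).2.1)
  rintro ⟨k1, l1⟩ hk1
  rw [Finset.mem_filter] at hk1
  set S2 := ((S.filter (fun y => q y.1 = q k0)).filter (fun y => q y.2 = q l1)) with hS2
  have hS2m : ∀ x ∈ S2, x ∈ S ∧ q x.1 = q k1 ∧ q x.2 = q l1 := by
    intro x hx
    simp only [hS2, Finset.mem_filter] at hx
    exact ⟨hx.1.1, hx.1.2.trans hk1.2.symm, hx.2⟩
  obtain ⟨g1, g2, g3, g4, g5⟩ := hS _ hk1.1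
  simp only at g1 g2 g3 g4 g5
  change (S2.card : ℝ) ≤ _
  refine dip_card_fib S2 (fun x => p x.1) _ _ (by norm_num) ?_ ?_
  · rintro ⟨k2, l2⟩ hk2
    obtain ⟨m1, m2, m3⟩ := hS2m _ hk2
    obtain ⟨f1, f2, f3, f4, f5⟩ := hS _ m1
    simp only at f1 f2 f3 f4 f5 m2 m3
    have hsub : S2.filter (fun y => p y.1 = p k2) ⊆
        Finset.Icc (k2 - 8) (k2 + 8) ×ˢ Finset.Icc (l2 - 8) (l2 + 8) := by
      rintro ⟨k, l⟩ hx
      rw [Finset.mem_filter] at hx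
      obtain ⟨n1, n2, n3⟩ := hS2m _ hx.1
      obtain ⟨h1, h2, h3, h4, h5⟩ := hS _ n1
      have hpk := hx.2
      simp only at h1 h2 h3 h4 h5 n2 n3 hpk
      rw [Finset.mem_product]
      constructor
      · apply dip_index J k k2 h1 f1
        rw [← hd]
        have := hdiff k h1 k2 f1
        have := hq2 k h1 k2 f1 (n2.trans m2.symm)
        have := hp2 k h1 k2 f1 hpk
        linarith
      · apply dip_index J l l2 h2 f2
        rw [← hd]
        have := hdiff l h2 l2 f2
        have := hq2 l h2 l2 f2 (n3.trans m3.symm)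
        have := hp2 l h2 l2 f2 (by rw [← h4, hpk, f4])
        linarith
    have hc := Finset.card_le_card hsub
    rw [Finset.card_product, Nat.card_Icc, Nat.card_Icc] at hc
    have e1 : k2 + 8 + 1 - (k2 - 8) ≤ 17 := by omega
    have e2 : l2 + 8 + 1 - (l2 - 8) ≤ 17 := by omega
    have hc' := hc.trans (Nat.mul_le_mul e1 e2)
    exact_mod_cast hc'
  · have hdj1 := hdj _ hk1.1
    have := dip_sep A s C hC (S2.image (fun x => p x.1)) d (46 * (1 / 2 ^ j))
      hd0 (by have : 0 < d := hd0; linarith) (p k1) (hPA _ (hpP _ g1)) ?_ ?_ ?_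
    · have e : 2 * (46 * (1 / 2 ^ j) / d) = 92 * (2 ^ J / 2 ^ j) := by rw [hd]; field_simp; norm_num
      rwa [e] at this
    · intro y hy
      obtain ⟨x, hx, rfl⟩ := Finset.mem_image.1 hy
      exact hPA _ (hpP _ (hS x (hS2m x hx).1).1)
    · intro y hy
      obtain ⟨⟨k, l⟩, hx, rfl⟩ := Finset.mem_image.1 hy
      obtain ⟨n1, n2, n3⟩ := hS2m _ hx
      obtain ⟨h1, h2, h3, h4, h5⟩ := hS _ n1
      simp only at h1 h2 h3 h4 h5 n2 n3 ⊢
      have w1 := hq2 k h1 k1 g1 n2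
      have w2 := hq2 l h2 l1 g2 n3
      have w3 := hp2 k h1 l h2 h4
      have w4 := hp2 k1 g1 l1 g2 g4
      have hang : |(k : ℝ) * d - k1 * d| ≤ 42 * (1 / 2 ^ j) := by
        by_cases hkl : k1 - l1 = 0
        · have : j = 0 := by rw [← g5, hkl]; simp
          rw [this]
          have t1 := hth k h1
          have t2 := hth k1 g1
          rw [abs_le]
          constructor <;> norm_num <;> linarith
        · have hle : 2 ^ j ≤ k1 - l1 := by rw [← g5]; exact Nat.pow_log_le_self 2 hkl
          have hle' : (2 : ℝ) ^ j ≤ k1 - l1 := by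
            have : ((2 ^ j : ℕ) : ℝ) ≤ ((k1 - l1 : ℕ) : ℝ) := by exact_mod_cast hle
            rw [Nat.cast_sub g3] at this
            push_cast at this
            exact this
          have := dip_geom (k * d) (l * d) (k1 * d) (l1 * d) d (2 ^ j * d) (hth l h2).1
            (mul_le_mul_of_nonneg_right (by exact_mod_cast h3) hd0.le) (hth k h1).2 (hth l1 g2).1
            (mul_le_mul_of_nonneg_right (by exact_mod_cast g3) hd0.le) (hth k1 g1).2 (by positivity)
            (by rw [← sub_mul]; exact mul_le_mul_of_nonneg_right hle' hd0.le) (by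
              rw [← hab k h1, ← hab l h2, ← hab k1 g1, ← hab l1 g2]
              rw [dist_eq_norm] at w1 w2 w3 w4
              have e : a k - b k - (a l - b l) - (a k1 - b k1 - (a l1 - b l1)) =
                (a k - a k1) - (a l - a l1) - ((b k - b l) - (b k1 - b l1)) := by abel
              rw [e]
              have v1 := norm_sub_le ((a k - a k1) - (a l - a l1)) ((b k - b l) - (b k1 - b l1))
              have v2 := norm_sub_le (a k - a k1) (a l - a l1)
              have v3 := norm_sub_le (b k - b l) (b k1 - b l1)
              linarith)
          refine this.trans (le_of_eq ?_)
          field_simp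
      have c1 := dipe_le (k * d) (k1 * d)
      have c3 : dist (b k) (b k1) ≤ dist (a k) (a k1) + dist (dipe (k * d)) (dipe (k1 * d)) := by
        rw [← hab k h1, ← hab k1 g1, dist_eq_norm, dist_eq_norm, dist_eq_norm]
        refine le_trans (le_of_eq ?_) (norm_sub_le _ _)
        congr 1; abel
      have c5 := hbp k h1
      have c6 := hbp k1 g1
      have c7 := dist_triangle4 (p k) (b k) (b k1) (p k1)
      rw [dist_comm (p k) (b k)] at c7
      linarith
    · intro y hy z hz
      obtain ⟨x, hx, rfl⟩ := Finset.mem_image.1 hy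
      obtain ⟨x', hx', rfl⟩ := Finset.mem_image.1 hz
      exact hsep _ (hpP _ (hS x (hS2m x hx).1).1) _ (hpP _ (hS x' (hS2m x' hx').1).1)

lemma dip_pairs (M : ℕ) (p : ℕ → DipE) (P : Finset DipE) (hp : ∀ k < M, p k ∈ P) [DecidableEq DipE] :
    (M : ℝ) ^ 2 ≤ P.card * ((((Finset.range M ×ˢ Finset.range M).filter (fun x => p x.1 = p x.2)).card : ℕ) : ℝ) := by
  have h1 : M = ∑ y ∈ P, ((Finset.range M).filter (fun k => p k = y)).card := by
    rw [← Finset.card_eq_sum_card_fiberwise (f := p) (s := Finset.range M) (t := P), Finset.card_range]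
    intro k hk
    exact hp k (by simpa using hk)
  have h2 : ((Finset.range M ×ˢ Finset.range M).filter (fun x => p x.1 = p x.2)).card =
      ∑ y ∈ P, ((Finset.range M).filter (fun k => p k = y)).card ^ 2 := by
    rw [Finset.card_eq_sum_card_fiberwise (f := fun x => p x.1) (t := P)]
    · refine Finset.sum_congr rfl ?_
      intro y _
      rw [sq, ← Finset.card_product]
      congr 1
      ext ⟨k, l⟩
      simp only [Finset.mem_filter, Finset.mem_product]
      constructor
      · rintro ⟨⟨⟨h1, h2⟩, h3⟩, h4⟩
        exact ⟨⟨h1, h4⟩, h2, h3 ▸ h4⟩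
      · rintro ⟨⟨h1, h4⟩, h2, h3⟩
        exact ⟨⟨⟨h1, h2⟩, h4.trans h3.symm⟩, h4⟩
    · intro x hx
      simp only [Finset.coe_filter, Finset.mem_product, Finset.mem_range, Set.mem_ofPred_eq] at hx
      exact hp _ hx.1.1
  rw [h2]
  have h3 := sq_sum_le_card_mul_sum_sq (s := P) (f := fun y => (((Finset.range M).filter (fun k => p k = y)).card))
  rw [← h1] at h3
  exact_mod_cast h3

lemma dip_count (A : Set DipE) (s C D : ℝ) (hs : 0 ≤ s) (hC0 : 0 < C) (hD1 : 1 ≤ D)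
    (hD : ∀ x ∈ A, ∀ y ∈ A, dist x y ≤ D)
    (hC : ∀ x ∈ A, ∀ R > 0, ∀ r, 0 < r → r < R →
      (((coverN r (Metric.closedBall x R ∩ A)).toNat : ℝ)) ≤ C * (R / r) ^ s)
    (h : Metric.sphere (0 : DipE) 1 ⊆ A - A) (J : ℕ) (hJ1 : 1 ≤ J) :
    ((2 : ℝ) ^ J) ^ 2 ≤ (C * (2 * D) ^ s) ^ 2 * (2 * (C ^ 2 * 1104 ^ s * 289)) * (J * (((2 : ℝ) ^ J) ^ s) ^ 3) := by
  classical
  have hJ : (0 : ℝ) < 2 ^ J := by positivity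
  set d : ℝ := ((2 : ℝ) ^ J)⁻¹ with hd
  have hd0 : 0 < d := by positivity
  have hab0 : ∀ k : ℕ, ∃ u v : DipE, u ∈ A ∧ v ∈ A ∧ u - v = dipe (k * d) := by
    intro k
    have : dipe (k * d) ∈ A - A := by
      apply h
      rw [mem_sphere_zero_iff_norm, EuclideanSpace.norm_eq, Fin.sum_univ_two]
      simp [dipe]
    obtain ⟨u, hu, v, hv, huv⟩ := Set.mem_sub.1 this
    exact ⟨u, v, hu, hv, huv⟩
  choose a b ha hb hab using hab0
  obtain ⟨P, hPT, hsep, hmax⟩ := dip_maxsep ((Finset.range (2 ^ J)).image a ∪ (Finset.range (2 ^ J)).image b) d hd0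
  have hPA : ∀ y ∈ P, y ∈ A := by
    intro y hy
    have := hPT hy
    simp only [Finset.mem_union, Finset.mem_image] at this
    rcases this with ⟨k, -, rfl⟩ | ⟨k, -, rfl⟩
    · exact ha k
    · exact hb k
  have hq0 : ∀ k : ℕ, ∃ z, k < 2 ^ J → z ∈ P ∧ dist (a k) z < d := by
    intro k
    by_cases hk : k < 2 ^ J
    · obtain ⟨z, hz⟩ := hmax (a k) (Finset.mem_union_left _ (Finset.mem_image_of_mem _ (Finset.mem_range.2 hk)))
      exact ⟨z, fun _ => hz⟩
    · exact ⟨0, fun h => absurd h hk⟩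
  have hp0 : ∀ k : ℕ, ∃ z, k < 2 ^ J → z ∈ P ∧ dist (b k) z < d := by
    intro k
    by_cases hk : k < 2 ^ J
    · obtain ⟨z, hz⟩ := hmax (b k) (Finset.mem_union_right _ (Finset.mem_image_of_mem _ (Finset.mem_range.2 hk)))
      exact ⟨z, fun _ => hz⟩
    · exact ⟨0, fun h => absurd h hk⟩
  choose q hq using hq0
  choose p hp using hp0
  have hd1 : d ≤ 1 := by
    rw [hd]; exact inv_le_one_of_one_le₀ (one_le_pow₀ (by norm_num))
  have hPc : (P.card : ℝ) ≤ C * (2 * D) ^ s * ((2 : ℝ) ^ J) ^ s := by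
    have := dip_sep A s C hC P d D hd0 (by linarith) (a 0) (ha 0) hPA (fun y hy => hD _ (hPA y hy) _ (ha 0)) hsep
    have e : 2 * (D / d) = (2 * D) * 2 ^ J := by rw [hd]; field_simp
    rw [e, Real.mul_rpow (by linarith) hJ.le] at this
    linarith
  have hpairs := dip_pairs (2 ^ J) p P (fun k hk => (hp k hk).1)
  set S := (Finset.range (2 ^ J) ×ˢ Finset.range (2 ^ J)).filter (fun x => p x.1 = p x.2) with hS
  set K : ℝ := P.card * (C ^ 2 * 1104 ^ s * 289 * ((2 : ℝ) ^ J) ^ s) with hK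
  set S1 := S.filter (fun x => x.2 ≤ x.1) with hS1
  have hS12 : S.card ≤ 2 * S1.card := by
    have : S ⊆ S1 ∪ S1.image Prod.swap := by
      rintro ⟨k, l⟩ hx
      rw [Finset.mem_union]
      rcases le_total l k with hkl | hkl
      · left; exact Finset.mem_filter.2 ⟨hx, hkl⟩
      · right
        refine Finset.mem_image.2 ⟨(l, k), ?_, rfl⟩
        simp only [hS1, hS, Finset.mem_filter, Finset.mem_product] at hx ⊢
        exact ⟨⟨⟨hx.1.2, hx.1.1⟩, hx.2.symm⟩, hkl⟩
    have h1 := Finset.card_le_card this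
    have h2 := Finset.card_union_le S1 (S1.image Prod.swap)
    have h3 : (S1.image Prod.swap).card ≤ S1.card := Finset.card_image_le
    omega
  have hS1c : (S1.card : ℝ) ≤ J * K := by
    rw [Finset.card_eq_sum_card_fiberwise (f := fun x : ℕ × ℕ => Nat.log 2 (x.1 - x.2)) (t := Finset.range J)]
    · push_cast
      have hsum := Finset.sum_le_card_nsmul (Finset.range J)
        (fun j => ((S1.filter (fun x : ℕ × ℕ => Nat.log 2 (x.1 - x.2) = j)).card : ℝ)) K (by
        intro j _
        have := dip_scale A s C hs hC0 hC J j d hd a b p q (fun k _ => hab k) P hPA hsep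
          (fun k hk => (hp k hk).1) (fun k hk => (hq k hk).1) (fun k hk => (hq k hk).2) (fun k hk => (hp k hk).2)
          (S1.filter (fun x : ℕ × ℕ => Nat.log 2 (x.1 - x.2) = j)) (by
            intro x hx
            simp only [hS1, hS, Finset.mem_filter, Finset.mem_product, Finset.mem_range] at hx
            exact ⟨hx.1.1.1.1, hx.1.1.1.2, hx.1.2, hx.1.1.2, hx.2⟩)
        refine this.trans (le_of_eq ?_)
        rw [hK]
        have hj : (0 : ℝ) < 2 ^ j := by positivity
        have e : (12 * (2 : ℝ) ^ j) ^ s * (92 * (2 ^ J / 2 ^ j)) ^ s = 1104 ^ s * ((2 : ℝ) ^ J) ^ s := by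
          rw [← Real.mul_rpow (by positivity) (by positivity), ← Real.mul_rpow (by positivity) (by positivity)]
          congr 1
          field_simp
          norm_num
        linear_combination (P.card * C ^ 2 * 289) * e)
      rw [Finset.card_range, nsmul_eq_mul] at hsum
      exact hsum
    · intro x hx
      simp only [hS1, hS, Finset.coe_filter, Finset.mem_filter, Finset.mem_product, Finset.mem_range,
        Set.mem_ofPred_eq] at hx
      simp only [Finset.coe_range, Set.mem_Iio]
      by_cases h0 : x.1 - x.2 = 0
      · rw [h0]; simp; omega
      · exact Nat.log_lt_of_lt_pow h0 (by omega)
  have hS12' : (S.card : ℝ) ≤ 2 * S1.card := by exact_mod_cast hS12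
  have hP0 : (0 : ℝ) ≤ P.card := by positivity
  push_cast at hpairs
  set X := ((2 : ℝ) ^ J) ^ s with hX
  have hX0 : 0 ≤ X := by positivity
  have hW : 0 ≤ C ^ 2 * 1104 ^ s * 289 := by positivity
  calc ((2 : ℝ) ^ J) ^ 2 ≤ P.card * S.card := hpairs
    _ ≤ P.card * (2 * (J * K)) := by
        apply mul_le_mul_of_nonneg_left _ hP0
        linarith
    _ = (P.card : ℝ) ^ 2 * (2 * (C ^ 2 * 1104 ^ s * 289) * (J * X)) := by rw [hK]; ring
    _ ≤ (C * (2 * D) ^ s * X) ^ 2 * (2 * (C ^ 2 * 1104 ^ s * 289) * (J * X)) := by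
        apply mul_le_mul_of_nonneg_right _ (by positivity)
        exact pow_le_pow_left₀ hP0 hPc 2
    _ = _ := by ring

theorem dipole_assouad_ge_two_thirds (A : Set (EuclideanSpace ℝ (Fin 2)))
    (hA : Bornology.IsBounded A)
    (h : Metric.sphere (0 : EuclideanSpace ℝ (Fin 2)) 1 ⊆ A - A) :
    (2 : ℝ) / 3 ≤ assouadDim A := by
  refine le_csInf (dip_nonempty A) ?_
  rintro s ⟨hs, C, hC0, hC⟩
  by_contra! hlt
  obtain ⟨D, hD⟩ := Metric.isBounded_iff.1 hA
  have hcount := dip_count A s C (max D 1) hs hC0 (le_max_right _ _)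
    (fun x hx y hy => (hD hx hy).trans (le_max_left _ _)) hC h
  set W := (C * (2 * max D 1) ^ s) ^ 2 * (2 * (C ^ 2 * 1104 ^ s * 289)) with hW
  have hmax : 0 < max D 1 := lt_of_lt_of_le one_pos (le_max_right _ _)
  have hW0 : 0 < W := by positivity
  -- ratio
  set ρ : ℝ := ((2 : ℝ) ^ s) ^ 3 / 2 ^ 2 with hρ
  have hρ0 : 0 ≤ ρ := by positivity
  have hρ1 : ρ < 1 := by
    rw [hρ, div_lt_one (by norm_num), ← Real.rpow_natCast, ← Real.rpow_mul (by norm_num)]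
    have : (2 : ℝ) ^ 2 = (2 : ℝ) ^ (2 : ℝ) := by norm_num
    rw [this]
    apply Real.rpow_lt_rpow_of_exponent_lt (by norm_num)
    push_cast
    linarith
  have hlim := (tendsto_self_mul_const_pow_of_lt_one hρ0 hρ1).const_mul W
  rw [mul_zero] at hlim
  have hev := (hlim.eventually (gt_mem_nhds (show (0 : ℝ) < 1 by norm_num))).and (eventually_ge_atTop 1)
  obtain ⟨J, hJ, hJ1⟩ := hev.exists
  have hc := hcount J hJ1
  have e : (((2 : ℝ) ^ J) ^ s) ^ 3 = ρ ^ J * ((2 : ℝ) ^ J) ^ 2 := by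
    rw [hρ, div_pow, ← pow_mul, ← pow_mul, mul_comm 2 J, pow_mul 2 J 2, div_mul_cancel₀ _ (by positivity)]
    rw [← Real.rpow_natCast 2 J, ← Real.rpow_mul (by norm_num), mul_comm (J : ℝ) s, Real.rpow_mul (by norm_num),
      Real.rpow_natCast]
    ring
  rw [e] at hc
  have hpos : (0 : ℝ) < ((2 : ℝ) ^ J) ^ 2 := by positivity
  have : ((2 : ℝ) ^ J) ^ 2 * (W * (J * ρ ^ J)) < ((2 : ℝ) ^ J) ^ 2 * 1 := mul_lt_mul_of_pos_left hJ hpos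
  linarith
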